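/- Let σ ∈ (0,1) and f_σ ∈ 𝔨 with AA* f_σ = σ² f_σ and ‖f_σ‖ = 1. Then for any μ₁, μ₂ ∈ ℂ, U( μ₁ (A*/σ) f_σ ⊕ μ₂ (B*/√(1−σ²)) f_σ ) = ν₁ f_σ ⊕ ν₂ (CA*/(σ√(1−σ²))) f_σ, where (ν₁, ν₂) = U_σ (μ₁, μ₂) with U_σ := [[σ, √(1−σ²)],[√(1−σ²), −σ]]. -/

import Mathlib

open ContinuousLinearMap Submodule in
/-- The adjoint of a compression `P_L T|_K` is the compression `P_K T*|_L`. -/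
theorem adjoint_compression_apply {H : Type*} [NormedAddCommGroup H] [InnerProductSpace ℂ H]
    [CompleteSpace H] (K L : Submodule ℂ H) [CompleteSpace K] [CompleteSpace L]
    (T : H →L[ℂ] H) (A : K →L[ℂ] L) (hA : ∀ x : K, A x = orthogonalProjectionOnto L (T x)) (y : L) :
    adjoint A y = orthogonalProjectionOnto K (adjoint T y) := by
  refine ext_inner_left ℂ fun x => ?_
  rw [adjoint_inner_right, hA, inner_orthogonalProjectionOnto_eq_of_mem_right,
    inner_orthogonalProjectionOnto_eq_of_mem_left, adjoint_inner_right]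

open ContinuousLinearMap Complex Submodule Polynomial in
theorem stmt13
    {H : Type*} [NormedAddCommGroup H] [InnerProductSpace ℂ H] [CompleteSpace H]
    (𝔥 𝔨 : Submodule ℂ H) [CompleteSpace 𝔥] [CompleteSpace 𝔨]
    (U : H →L[ℂ] H) (hU1 : adjoint U ∘L U = 1) (hU2 : U ∘L adjoint U = 1)
    (A : 𝔥 →L[ℂ] 𝔨) (B : 𝔥ᗮ →L[ℂ] 𝔨) (C : 𝔥 →L[ℂ] 𝔨ᗮ) (D : 𝔥ᗮ →L[ℂ] 𝔨ᗮ)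
    (hA : ∀ x : 𝔥, A x = orthogonalProjection 𝔨 (U x))
    (hB : ∀ y : 𝔥ᗮ, B y = orthogonalProjection 𝔨 (U y))
    (hC : ∀ x : 𝔥, C x = orthogonalProjection 𝔨ᗮ (U x))
    (hD : ∀ y : 𝔥ᗮ, D y = orthogonalProjection 𝔨ᗮ (U y))
    (σ : ℝ) (hσ : σ ∈ Set.Ioo (0 : ℝ) 1) (fσ : 𝔨) (hfnorm : ‖fσ‖ = 1)
    (hf : A (adjoint A fσ) = ((σ : ℂ) ^ 2) • fσ)
    (μ₁ μ₂ ν₁ ν₂ : ℂ)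
    (hν₁ : ν₁ = (σ : ℂ) * μ₁ + (Real.sqrt (1 - σ ^ 2) : ℂ) * μ₂)
    (hν₂ : ν₂ = (Real.sqrt (1 - σ ^ 2) : ℂ) * μ₁ - (σ : ℂ) * μ₂) :
    U ((μ₁ / (σ : ℂ)) • ((adjoint A fσ : 𝔥) : H) +
        (μ₂ / (Real.sqrt (1 - σ ^ 2) : ℂ)) • ((adjoint B fσ : 𝔥ᗮ) : H)) =
      ν₁ • (fσ : H) +
        (ν₂ / ((σ : ℂ) * (Real.sqrt (1 - σ ^ 2) : ℂ))) • ((C (adjoint A fσ) : 𝔨ᗮ) : H) := by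
  have hadj : ((adjoint A fσ : 𝔥) : H) + ((adjoint B fσ : 𝔥ᗮ) : H) = adjoint U fσ := by
    rw [adjoint_compression_apply 𝔥 𝔨 U A hA, adjoint_compression_apply 𝔥ᗮ 𝔨 U B hB]
    exact starProjection_add_starProjection_orthogonal (K := 𝔥) _
  have hUadj : U (adjoint A fσ : 𝔥) + U (adjoint B fσ : 𝔥ᗮ) = fσ := by
    rw [← map_add, hadj]
    exact congr($hU2 (fσ : H))
  have hUA : U (adjoint A fσ : 𝔥) =
      ((σ : ℂ) ^ 2) • (fσ : H) + ((C (adjoint A fσ) : 𝔨ᗮ) : H) := by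
    rw [hC, ← Submodule.coe_smul, ← hf, hA]
    exact (starProjection_add_starProjection_orthogonal (K := 𝔨) _).symm
  have hpos : 0 < 1 - σ ^ 2 := by nlinarith [hσ.1, hσ.2]
  have hσ0 : (σ : ℂ) ≠ 0 := ofReal_ne_zero.mpr hσ.1.ne'
  have hs0 : (Real.sqrt (1 - σ ^ 2) : ℂ) ≠ 0 := ofReal_ne_zero.mpr (Real.sqrt_pos.mpr hpos).ne'
  have hs : (Real.sqrt (1 - σ ^ 2) : ℂ) ^ 2 = 1 - (σ : ℂ) ^ 2 := by
    exact_mod_cast congrArg ofReal (Real.sq_sqrt hpos.le)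
  rw [map_add, map_smul, map_smul, eq_sub_of_add_eq' hUadj, hUA, hν₁, hν₂]
  generalize (Real.sqrt (1 - σ ^ 2) : ℂ) = s at *
  match_scalars
  · field_simp
    linear_combination -μ₂ * hs
  · field_simp
    ring
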